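/- Suppose δ < (d−1)/(d+1), β < 2δ/(d(d−1)) + (d−2)/d, and liminf_n p_n > 0. Let Ĥ(A) = { Ψ ⊆ [n] : |Ψ| = d and every pair of distinct vertices of Ψ is an edge of A } be the clique estimator. Then, with (H,A) ∼ ℙ, limsup_n E[ |Ĥ(A) △ H| ] / ( s_n·C(n,d) ) < 1; i.e., the clique estimator achieves partial reconstruction. -/

import Mathlib

open Finset Filter
open scoped Classical symmDiff

noncomputable section

namespace NoisyHypergraph

/-- The set of unordered pairs of distinct vertices of `[n]`, encoded as 2-element subsets. -/
def pairs (n : ℕ) : Finset (Finset (Fin n)) :=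
  (Finset.univ : Finset (Fin n)).powersetCard 2

/-- The set of `d`-element subsets of `[n]` (potential hyperedges). -/
def dsets (n d : ℕ) : Finset (Finset (Fin n)) :=
  (Finset.univ : Finset (Fin n)).powersetCard d

/-- Projection of a hypergraph: all pairs of distinct vertices contained in some hyperedge. -/
def proj (n : ℕ) (H : Finset (Finset (Fin n))) : Finset (Finset (Fin n)) :=
  (pairs n).filter fun e => ∃ Ψ ∈ H, e ⊆ Ψ

/-- Mass function of `μ_{n,d,s}`: each `d`-subset included independently with probability `s`. -/
def mu (n d : ℕ) (s : ℝ) (H : Finset (Finset (Fin n))) : ℝ :=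
  s ^ H.card * (1 - s) ^ ((dsets n d).card - H.card)

/-- Conditional mass function of the noisy projection `A` given the hypergraph `H`:
edges of `P(H)` kept with probability `p`, other pairs added with probability `q`. -/
def condP (n : ℕ) (p q : ℝ) (H A : Finset (Finset (Fin n))) : ℝ :=
  p ^ (A ∩ proj n H).card * (1 - p) ^ (proj n H \ A).card *
    q ^ (A \ proj n H).card * (1 - q) ^ ((pairs n \ proj n H) \ A).card

/-- Erdős–Rényi `G(n,q)` mass function. -/
def er (n : ℕ) (q : ℝ) (A : Finset (Finset (Fin n))) : ℝ :=
  q ^ A.card * (1 - q) ^ ((pairs n).card - A.card)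

/-- Joint planted mass function of `(H, A)` under `ℙ`. -/
def joint (n d : ℕ) (s p q : ℝ) (H A : Finset (Finset (Fin n))) : ℝ :=
  mu n d s H * condP n p q H A

/-- Marginal law of `A` under the planted measure `ℙ`. -/
def marg (n d : ℕ) (s p q : ℝ) (A : Finset (Finset (Fin n))) : ℝ :=
  ∑ H ∈ (dsets n d).powerset, joint n d s p q H A

/-- Probability of an event under the joint planted law `ℙ`. -/
def prJoint (n d : ℕ) (s p q : ℝ)
    (E : Finset (Finset (Fin n)) → Finset (Finset (Fin n)) → Prop) : ℝ :=
  ∑ H ∈ (dsets n d).powerset, ∑ A ∈ (pairs n).powerset,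
    if E H A then joint n d s p q H A else 0

/-- Probability of an event under the Erdős–Rényi law. -/
def prER (n : ℕ) (q : ℝ) (E : Finset (Finset (Fin n)) → Prop) : ℝ :=
  ∑ A ∈ (pairs n).powerset, if E A then er n q A else 0

/-- The clique estimator `Ĥ(A)`: all `d`-subsets of `[n]` that form a clique in `A`. -/
def cliqueEst (n d : ℕ) (A : Finset (Finset (Fin n))) : Finset (Finset (Fin n)) :=
  (dsets n d).filter fun Ψ => ∀ e ∈ pairs n, e ⊆ Ψ → e ∈ A


/-- Inclusion probability of the pair `e` given `H`. -/
def aux_a (n : ℕ) (p q : ℝ) (H : Finset (Finset (Fin n))) (e : Finset (Fin n)) : ℝ :=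
  if e ∈ proj n H then p else q

lemma condP_eq (n : ℕ) (p q : ℝ) (H A : Finset (Finset (Fin n))) (hA : A ⊆ pairs n) :
    condP n p q H A =
      (∏ e ∈ A, aux_a n p q H e) * ∏ e ∈ pairs n \ A, (1 - aux_a n p q H e) := by
  have hP : proj n H ⊆ pairs n := Finset.filter_subset _ _
  have h1 : ∏ e ∈ A, aux_a n p q H e = p ^ (A ∩ proj n H).card * q ^ (A \ proj n H).card := by
    unfold aux_a
    rw [Finset.prod_ite, Finset.prod_const, Finset.prod_const]
    congr 3 <;> ext x <;> simp
  have h2 : ∏ e ∈ pairs n \ A, (1 - aux_a n p q H e) =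
      (1 - p) ^ (proj n H \ A).card * (1 - q) ^ ((pairs n \ proj n H) \ A).card := by
    have : ∀ e, 1 - aux_a n p q H e = if e ∈ proj n H then 1 - p else 1 - q := by
      intro e; unfold aux_a; split_ifs <;> rfl
    simp only [this]
    rw [Finset.prod_ite, Finset.prod_const, Finset.prod_const]
    congr 3
    · ext x
      simp only [Finset.mem_filter, Finset.mem_sdiff]
      constructor
      · rintro ⟨⟨_, h⟩, h'⟩; exact ⟨h', h⟩
      · rintro ⟨h, h'⟩; exact ⟨⟨hP h, h'⟩, h⟩
    · ext x
      simp only [Finset.mem_filter, Finset.mem_sdiff]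
      tauto
  rw [h1, h2, condP]; ring

lemma sum_condP_superset (n : ℕ) (p q : ℝ) (H T : Finset (Finset (Fin n))) (hT : T ⊆ pairs n) :
    ∑ A ∈ (pairs n).powerset, condP n p q H A * (if T ⊆ A then 1 else 0) =
      ∏ e ∈ T, aux_a n p q H e := by
  have h := Finset.prod_add (fun e => aux_a n p q H e)
    (fun e => if e ∈ T then 0 else 1 - aux_a n p q H e) (pairs n)
  have h1 : ∏ e ∈ pairs n, (aux_a n p q H e + if e ∈ T then 0 else 1 - aux_a n p q H e)
      = ∏ e ∈ T, aux_a n p q H e := by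
    rw [← Finset.prod_subset hT]
    · apply Finset.prod_congr rfl
      intro e he; simp [he]
    · intro e _ he; simp [he]
  rw [← h1, h]
  apply Finset.sum_congr rfl
  intro A hA
  rw [Finset.mem_powerset] at hA
  rw [condP_eq n p q H A hA, mul_assoc]
  congr 1
  by_cases hTA : T ⊆ A
  · simp only [hTA, if_true, mul_one]
    apply Finset.prod_congr rfl
    intro e he
    have : e ∉ T := fun h => (Finset.mem_sdiff.1 he).2 (hTA h)
    simp [this]
  · simp only [hTA, if_false, mul_zero]
    obtain ⟨e, he, he'⟩ := Finset.not_subset.1 hTA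
    symm
    apply Finset.prod_eq_zero (Finset.mem_sdiff.2 ⟨hT he, he'⟩)
    simp [he]

lemma sum_mu_prod (n d : ℕ) (s : ℝ) (G : Finset (Fin n) → ℝ) :
    ∑ H ∈ (dsets n d).powerset, mu n d s H * ∏ h ∈ H, G h =
      ∏ h ∈ dsets n d, (s * G h + (1 - s)) := by
  rw [Finset.prod_add]
  apply Finset.sum_congr rfl
  intro H hH
  rw [Finset.mem_powerset] at hH
  rw [Finset.prod_mul_distrib, Finset.prod_const, Finset.prod_const,
    Finset.card_sdiff_of_subset hH, mu]
  ring

lemma sum_mu_mem (n d : ℕ) (s : ℝ) (Ψ : Finset (Fin n)) (hΨ : Ψ ∈ dsets n d) :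
    ∑ H ∈ (dsets n d).powerset, mu n d s H * (if Ψ ∈ H then 1 else 0) = s := by
  have h0 := sum_mu_prod n d s (fun _ => 1)
  have h1 := sum_mu_prod n d s (fun h => if h = Ψ then 0 else 1)
  have e0 : ∏ h ∈ dsets n d, (s * (1 : ℝ) + (1 - s)) = 1 := by simp
  have e1 : ∏ h ∈ dsets n d, (s * (if h = Ψ then (0 : ℝ) else 1) + (1 - s)) = 1 - s := by
    rw [Finset.prod_eq_single Ψ]
    · simp
    · intro b _ hb; simp [hb]
    · intro h; exact absurd hΨ h
  rw [e0] at h0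
  rw [e1] at h1
  refine Eq.trans ?_ (show (1 : ℝ) - (1 - s) = s by ring)
  refine Eq.trans ?_ (congrArg₂ (fun x y : ℝ => x - y) h0 h1)
  rw [← Finset.sum_sub_distrib]
  apply Finset.sum_congr rfl
  intro H _
  by_cases hm : Ψ ∈ H
  · have hz : ∏ h ∈ H, (if h = Ψ then (0 : ℝ) else 1) = 0 :=
      Finset.prod_eq_zero hm (by simp)
    rw [hz]; simp [hm]
  · have hz : ∏ h ∈ H, (if h = Ψ then (0 : ℝ) else 1) = 1 := by
      apply Finset.prod_eq_one
      intro h hh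
      have : h ≠ Ψ := fun h' => hm (h' ▸ hh)
      simp [this]
    rw [hz]; simp [hm]

lemma mem_dsets {n d : ℕ} {Ψ : Finset (Fin n)} : Ψ ∈ dsets n d ↔ Ψ.card = d := by
  simp [dsets, Finset.mem_powersetCard]

lemma mem_cliqueEst {n d : ℕ} {A : Finset (Finset (Fin n))} {Ψ : Finset (Fin n)}
    (hΨ : Ψ ∈ dsets n d) : Ψ ∈ cliqueEst n d A ↔ Ψ.powersetCard 2 ⊆ A := by
  simp only [cliqueEst, Finset.mem_filter, hΨ, true_and, pairs, Finset.mem_powersetCard,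
    Finset.subset_univ]
  constructor
  · intro h e he
    rw [Finset.mem_powersetCard] at he
    exact h e he.2 he.1
  · intro h e he he'
    exact h (Finset.mem_powersetCard.2 ⟨he', he⟩)

lemma mu_nonneg (n d : ℕ) (s : ℝ) (h0 : 0 ≤ s) (h1 : s ≤ 1) (H : Finset (Finset (Fin n))) :
    0 ≤ mu n d s H := by
  unfold mu
  have : 0 ≤ 1 - s := by linarith
  positivity

lemma condP_nonneg (n : ℕ) (p q : ℝ) (hp0 : 0 ≤ p) (hp1 : p ≤ 1) (hq0 : 0 ≤ q) (hq1 : q ≤ 1)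
    (H A : Finset (Finset (Fin n))) : 0 ≤ condP n p q H A := by
  unfold condP
  have : 0 ≤ 1 - p := by linarith
  have : 0 ≤ 1 - q := by linarith
  positivity

/-- deterministic bound on the clique probability given `H`. -/
lemma prod_aux_le (n : ℕ) (p q t : ℝ) (hp0 : 0 ≤ p) (hp1 : p ≤ 1) (hq0 : 0 ≤ q)
    (hqt : q ≤ t) (ht0 : 0 < t) (ht1 : t ≤ 1)
    (H : Finset (Finset (Fin n))) (Ψ : Finset (Fin n)) :
    ∏ e ∈ Ψ.powersetCard 2, aux_a n p q H e ≤
      t ^ (Ψ.card.choose 2) * ∏ h ∈ H, (t⁻¹) ^ ((h ∩ Ψ).card.choose 2) := by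
  set T := Ψ.powersetCard 2 with hT
  have hti : 1 ≤ t⁻¹ := (one_le_inv₀ ht0).2 ht1
  have h1 : ∏ e ∈ T, aux_a n p q H e ≤ ∏ e ∈ T, t * (if e ∈ proj n H then t⁻¹ else 1) := by
    apply Finset.prod_le_prod
    · intro e _; unfold aux_a; split_ifs <;> assumption
    · intro e _; unfold aux_a
      split_ifs
      · rw [mul_inv_cancel₀ ht0.ne']; exact hp1
      · simpa using hqt
  refine h1.trans ?_
  rw [Finset.prod_mul_distrib, Finset.prod_const, Finset.prod_ite, Finset.prod_const,
    Finset.prod_const_one, mul_one, hT, Finset.card_powersetCard, Finset.prod_pow_eq_pow_sum]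
  apply mul_le_mul_of_nonneg_left _ (by positivity)
  apply pow_le_pow_right₀ hti
  have hsub : (Ψ.powersetCard 2).filter (fun e => e ∈ proj n H) ⊆
      H.biUnion (fun h => (h ∩ Ψ).powersetCard 2) := by
    intro e he
    simp only [Finset.mem_filter, Finset.mem_powersetCard, proj] at he
    obtain ⟨⟨heΨ, hc⟩, _, h, hh, heh⟩ := he
    exact Finset.mem_biUnion.2 ⟨h, hh, Finset.mem_powersetCard.2 ⟨Finset.subset_inter heh heΨ, hc⟩⟩
  refine (Finset.card_le_card hsub).trans (Finset.card_biUnion_le.trans ?_)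
  apply le_of_eq
  apply Finset.sum_congr rfl
  intro h _
  rw [Finset.card_powersetCard]

lemma count_inter (n d m : ℕ) (hm : m ≤ d) (Ψ : Finset (Fin n)) (hΨ : Ψ ∈ dsets n d) :
    (((dsets n d).filter (fun h => (h ∩ Ψ).card = m)).card : ℝ) ≤ 2 ^ d * (n : ℝ) ^ (d - m) := by
  have h1 : ((dsets n d).filter (fun h => (h ∩ Ψ).card = m)).card ≤
      (Ψ.powerset ×ˢ (Finset.univ : Finset (Fin n)).powersetCard (d - m)).card := by
    apply Finset.card_le_card_of_injOn (fun h => (h ∩ Ψ, h \ Ψ))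
    · intro h hh
      simp only [Finset.coe_filter, Set.mem_setOf_eq, mem_dsets] at hh
      simp only [Finset.coe_product, Set.mem_prod, Finset.mem_coe, Finset.mem_powerset,
        Finset.mem_powersetCard, Finset.subset_univ, true_and]
      refine ⟨Finset.inter_subset_right, ?_⟩
      have := Finset.card_inter_add_card_sdiff h Ψ
      omega
    · intro a _ b _ hab
      simp only [Prod.mk.injEq] at hab
      rw [← Finset.sdiff_union_inter a Ψ, ← Finset.sdiff_union_inter b Ψ, hab.1, hab.2]
  have h2 : (Ψ.powerset ×ˢ (Finset.univ : Finset (Fin n)).powersetCard (d - m)).card ≤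
      2 ^ d * n ^ (d - m) := by
    rw [Finset.card_product, Finset.card_powerset, Finset.card_powersetCard, mem_dsets.1 hΨ,
      Finset.card_univ, Fintype.card_fin]
    exact Nat.mul_le_mul_left _ (Nat.choose_le_pow _ _)
  exact_mod_cast h1.trans h2

lemma false_pos (n d : ℕ) (s p q t : ℝ) (hs0 : 0 < s) (hs1 : s ≤ 1)
    (hp0 : 0 ≤ p) (hp1 : p ≤ 1) (hq0 : 0 ≤ q)
    (hqt : q ≤ t) (ht0 : 0 < t) (ht1 : t ≤ 1)
    (hB : ∀ m ∈ Finset.Ico 2 d, s * (n : ℝ) ^ (d - m) * (t⁻¹) ^ (m.choose 2) ≤ 1)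
    (Ψ : Finset (Fin n)) (hΨ : Ψ ∈ dsets n d) :
    ∑ H ∈ (dsets n d).powerset, mu n d s H *
      ((if Ψ ∈ H then 0 else 1) * ∏ e ∈ Ψ.powersetCard 2, aux_a n p q H e) ≤
      t ^ (d.choose 2) * Real.exp (d * 2 ^ d) := by
  set G : Finset (Fin n) → ℝ := fun h => if h = Ψ then 0 else (t⁻¹) ^ ((h ∩ Ψ).card.choose 2)
    with hG
  have hG0 : ∀ h, 0 ≤ G h := by
    intro h; simp only [hG]; split_ifs <;> positivity
  have step1 : ∑ H ∈ (dsets n d).powerset, mu n d s H *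
      ((if Ψ ∈ H then 0 else 1) * ∏ e ∈ Ψ.powersetCard 2, aux_a n p q H e) ≤
      ∑ H ∈ (dsets n d).powerset, t ^ (d.choose 2) * (mu n d s H * ∏ h ∈ H, G h) := by
    apply Finset.sum_le_sum
    intro H _
    rw [mul_left_comm (t ^ (d.choose 2))]
    apply mul_le_mul_of_nonneg_left _ (mu_nonneg n d s hs0.le hs1 H)
    by_cases hm : Ψ ∈ H
    · simp only [hm, if_true, zero_mul]
      exact mul_nonneg (by positivity) (Finset.prod_nonneg fun h _ => hG0 h)
    · simp only [hm, if_false, one_mul]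
      have := prod_aux_le n p q t hp0 hp1 hq0 hqt ht0 ht1 H Ψ
      rw [mem_dsets.1 hΨ] at this
      refine this.trans (le_of_eq ?_)
      congr 1
      apply Finset.prod_congr rfl
      intro h hh
      have : h ≠ Ψ := fun h' => hm (h' ▸ hh)
      simp [hG, this]
  refine step1.trans ?_
  rw [← Finset.mul_sum, sum_mu_prod]
  apply mul_le_mul_of_nonneg_left _ (by positivity)
  have step2 : ∏ h ∈ dsets n d, (s * G h + (1 - s)) ≤
      ∏ h ∈ dsets n d, Real.exp (s * (G h - 1)) := by
    apply Finset.prod_le_prod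
    · intro h _
      have := mul_nonneg hs0.le (hG0 h)
      linarith
    · intro h _
      have := Real.add_one_le_exp (s * (G h - 1))
      linarith
  refine step2.trans ?_
  rw [← Real.exp_sum]
  apply Real.exp_le_exp.2
  have step3 : ∀ h ∈ dsets n d, s * (G h - 1) ≤
      ∑ m ∈ Finset.Ico 2 d, if (h ∩ Ψ).card = m then s * (t⁻¹) ^ (m.choose 2) else 0 := by
    intro h hh
    have hnn : 0 ≤ ∑ m ∈ Finset.Ico 2 d,
        if (h ∩ Ψ).card = m then s * (t⁻¹) ^ (m.choose 2) else 0 := by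
      apply Finset.sum_nonneg; intro m _; split_ifs <;> positivity
    by_cases hm : h = Ψ
    · refine le_trans ?_ hnn
      simp [hG, hm]; exact hs0.le
    by_cases h2 : (h ∩ Ψ).card < 2
    · refine le_trans ?_ hnn
      simp [hG, hm, Nat.choose_eq_zero_of_lt h2]
    have hlt : (h ∩ Ψ).card < d := by
      rw [← mem_dsets.1 hh]
      apply Finset.card_lt_card
      refine ⟨Finset.inter_subset_left, fun hs => hm ?_⟩
      apply Finset.eq_of_subset_of_card_le (hs.trans Finset.inter_subset_right)
      rw [mem_dsets.1 hh, mem_dsets.1 hΨ]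
    rw [Finset.sum_ite_eq, if_pos (Finset.mem_Ico.2 ⟨by omega, hlt⟩)]
    simp only [hG, hm, if_false]
    nlinarith
  refine (Finset.sum_le_sum step3).trans ?_
  rw [Finset.sum_comm]
  have step4 : ∀ m ∈ Finset.Ico 2 d,
      (∑ h ∈ dsets n d, if (h ∩ Ψ).card = m then s * (t⁻¹) ^ (m.choose 2) else 0) ≤ 2 ^ d := by
    intro m hm
    rw [← Finset.sum_filter, Finset.sum_const, nsmul_eq_mul]
    have hc := count_inter n d m (Finset.mem_Ico.1 hm).2.le Ψ hΨ
    have hb := hB m hm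
    have hpos : 0 ≤ s * (t⁻¹) ^ (m.choose 2) := by positivity
    calc _ ≤ (2 ^ d * (n : ℝ) ^ (d - m)) * (s * (t⁻¹) ^ (m.choose 2)) :=
          mul_le_mul_of_nonneg_right hc hpos
      _ = 2 ^ d * (s * (n : ℝ) ^ (d - m) * (t⁻¹) ^ (m.choose 2)) := by ring
      _ ≤ 2 ^ d * 1 := mul_le_mul_of_nonneg_left hb (by positivity)
      _ = 2 ^ d := mul_one _
  refine (Finset.sum_le_sum step4).trans ?_
  rw [Finset.sum_const, nsmul_eq_mul, Nat.card_Ico]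
  apply mul_le_mul_of_nonneg_right _ (by positivity)
  exact_mod_cast Nat.sub_le _ _

lemma card_symmDiff_eq (n d : ℕ) (H A : Finset (Finset (Fin n))) (hH : H ⊆ dsets n d) :
    ((cliqueEst n d A ∆ H).card : ℝ) = ∑ Ψ ∈ dsets n d,
      ((if Ψ ∈ H then 1 else 0) * (1 - (if Ψ.powersetCard 2 ⊆ A then 1 else 0)) +
        (if Ψ ∈ H then 0 else 1) * (if Ψ.powersetCard 2 ⊆ A then 1 else 0)) := by
  have hsub : cliqueEst n d A ∆ H ⊆ dsets n d := by
    intro x hx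
    rcases Finset.mem_symmDiff.1 hx with h | h
    · exact (Finset.mem_filter.1 h.1).1
    · exact hH h.1
  have h1 : cliqueEst n d A ∆ H = (dsets n d).filter (fun Ψ => Ψ ∈ cliqueEst n d A ∆ H) := by
    ext x; simp only [Finset.mem_filter]; exact ⟨fun h => ⟨hsub h, h⟩, fun h => h.2⟩
  rw [h1, Finset.card_filter, Nat.cast_sum]
  apply Finset.sum_congr rfl
  intro Ψ hΨ
  have hiff := Finset.mem_symmDiff (s := cliqueEst n d A) (t := H) (a := Ψ)
  rw [mem_cliqueEst hΨ] at hiff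
  simp only [hiff]
  by_cases a : Ψ ∈ H <;> by_cases b : Ψ.powersetCard 2 ⊆ A <;> simp [a, b]

lemma risk_bound (n d : ℕ) (s p q t : ℝ) (hs0 : 0 < s) (hs1 : s ≤ 1)
    (hp0 : 0 ≤ p) (hp1 : p ≤ 1) (hq0 : 0 ≤ q)
    (hqt : q ≤ t) (ht0 : 0 < t) (ht1 : t ≤ 1)
    (hB : ∀ m ∈ Finset.Ico 2 d, s * (n : ℝ) ^ (d - m) * (t⁻¹) ^ (m.choose 2) ≤ 1) :
    (∑ H ∈ (dsets n d).powerset, ∑ A ∈ (pairs n).powerset,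
      joint n d s p q H A * ((cliqueEst n d A ∆ H).card : ℝ)) ≤
      (n.choose d : ℝ) * (s * (1 - p ^ (d.choose 2)) +
        t ^ (d.choose 2) * Real.exp (d * 2 ^ d)) := by
  have hTp : ∀ Ψ : Finset (Fin n), Ψ.powersetCard 2 ⊆ pairs n := fun Ψ =>
    Finset.powersetCard_mono (Finset.subset_univ _)
  have e1 : ∀ H ∈ (dsets n d).powerset, ∑ A ∈ (pairs n).powerset,
      joint n d s p q H A * ((cliqueEst n d A ∆ H).card : ℝ) =
      ∑ Ψ ∈ dsets n d, (mu n d s H * (if Ψ ∈ H then 1 else 0) * (1 - p ^ (d.choose 2)) +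
        mu n d s H * ((if Ψ ∈ H then 0 else 1) *
          ∏ e ∈ Ψ.powersetCard 2, aux_a n p q H e)) := by
    intro H hH
    rw [Finset.mem_powerset] at hH
    have : ∀ A ∈ (pairs n).powerset, joint n d s p q H A * ((cliqueEst n d A ∆ H).card : ℝ) =
        ∑ Ψ ∈ dsets n d, joint n d s p q H A *
      ((if Ψ ∈ H then 1 else 0) * (1 - (if Ψ.powersetCard 2 ⊆ A then 1 else 0)) +
        (if Ψ ∈ H then 0 else 1) * (if Ψ.powersetCard 2 ⊆ A then 1 else 0)) := by
      intro A _
      rw [card_symmDiff_eq n d H A hH, Finset.mul_sum]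
    rw [Finset.sum_congr rfl this, Finset.sum_comm]
    apply Finset.sum_congr rfl
    intro Ψ hΨ
    have f1 := sum_condP_superset n p q H (Ψ.powersetCard 2) (hTp Ψ)
    have f0 := sum_condP_superset n p q H ∅ (Finset.empty_subset _)
    simp only [Finset.empty_subset, if_true, mul_one, Finset.prod_empty] at f0
    by_cases hm : Ψ ∈ H
    · have f2 : ∏ e ∈ Ψ.powersetCard 2, aux_a n p q H e = p ^ (d.choose 2) := by
        rw [Finset.prod_congr rfl (g := fun _ => p)]
        · rw [Finset.prod_const, Finset.card_powersetCard, mem_dsets.1 hΨ]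
        · intro e he
          have : e ∈ proj n H := Finset.mem_filter.2
            ⟨hTp Ψ he, Ψ, hm, (Finset.mem_powersetCard.1 he).1⟩
          simp [aux_a, this]
      rw [f2] at f1
      simp only [hm, if_true, one_mul, zero_mul, add_zero, mul_one, mul_zero]
      rw [← f1]
      have f3 : ∀ X : ℝ, 1 - X = (∑ A ∈ (pairs n).powerset, condP n p q H A) - X := by
        intro X; rw [f0]
      rw [f3 (∑ A ∈ (pairs n).powerset, _), ← Finset.sum_sub_distrib, Finset.mul_sum]
      apply Finset.sum_congr rfl
      intro A _
      rw [joint]; ring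
    · simp only [hm, if_false, one_mul, zero_mul, zero_add, mul_zero]
      rw [← f1, Finset.mul_sum]
      apply Finset.sum_congr rfl
      intro A _
      rw [joint]; ring
  rw [Finset.sum_congr rfl e1, Finset.sum_comm]
  have e2 : ∀ Ψ ∈ dsets n d, ∑ H ∈ (dsets n d).powerset,
      (mu n d s H * (if Ψ ∈ H then 1 else 0) * (1 - p ^ (d.choose 2)) +
        mu n d s H * ((if Ψ ∈ H then 0 else 1) *
          ∏ e ∈ Ψ.powersetCard 2, aux_a n p q H e)) ≤
      s * (1 - p ^ (d.choose 2)) + t ^ (d.choose 2) * Real.exp (d * 2 ^ d) := by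
    intro Ψ hΨ
    rw [Finset.sum_add_distrib, ← Finset.sum_mul, sum_mu_mem n d s Ψ hΨ]
    have := false_pos n d s p q t hs0 hs1 hp0 hp1 hq0 hqt ht0 ht1 hB Ψ hΨ
    linarith
  refine (Finset.sum_le_sum e2).trans (le_of_eq ?_)
  rw [Finset.sum_const, nsmul_eq_mul, dsets, Finset.card_powersetCard, Finset.card_univ,
    Fintype.card_fin]

lemma exists_gamma (d : ℕ) (hd : 2 ≤ d) (δ β : ℝ)
    (hδ : 0 ≤ δ ∧ δ < ((d : ℝ) - 1) / ((d : ℝ) + 1))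
    (hβ : 0 ≤ β ∧ β < 2 * δ / ((d : ℝ) * ((d : ℝ) - 1)) + ((d : ℝ) - 2) / (d : ℝ)) :
    ∃ γ : ℝ, 0 < γ ∧ γ < 1 - β ∧ (d : ℝ) - 1 - δ < γ * (d.choose 2 : ℕ) ∧
      ∀ m ∈ Finset.Ico 2 d, γ * (m.choose 2 : ℕ) < (m : ℝ) - 1 - δ := by
  have hd' : (2 : ℝ) ≤ d := by exact_mod_cast hd
  have hd0 : (0 : ℝ) < d := by linarith
  have hd1 : (0 : ℝ) < (d : ℝ) - 1 := by linarith
  have hδ2 : δ * ((d : ℝ) + 1) < (d : ℝ) - 1 := (lt_div_iff₀ (by linarith)).1 hδ.2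
  set c : ℝ := 2 * ((d : ℝ) - 1 - δ) / (d * (d - 1)) with hc
  have hδ1 : 0 < (d : ℝ) - 1 - δ := by nlinarith [hδ.1]
  have hc0 : 0 < c := by positivity
  have hcmul : c * (d * (d - 1)) = 2 * ((d : ℝ) - 1 - δ) := by
    rw [hc]; field_simp
  have hc1 : c < 1 - β := by
    have : 2 * δ / ((d : ℝ) * ((d : ℝ) - 1)) + ((d : ℝ) - 2) / (d : ℝ) = 1 - c := by
      rw [hc]; field_simp; ring
    linarith [hβ.2]
  have hc2 : ∀ m ∈ Finset.Ico 2 d, c * (m.choose 2 : ℕ) < (m : ℝ) - 1 - δ := by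
    intro m hm
    rw [Finset.mem_Ico] at hm
    have hm2 : (2 : ℝ) ≤ m := by exact_mod_cast hm.1
    have hmd : (m : ℝ) + 1 ≤ d := by exact_mod_cast hm.2
    rw [Nat.cast_choose_two]
    have key : 0 < (d - m : ℝ) * ((d - 1) * (m - 1) - δ * (d + m - 1)) := by
      apply mul_pos (by linarith)
      have hδlt : δ < 1 := by nlinarith [hδ.1]
      nlinarith [hδ.1, mul_nonneg (sub_nonneg.2 hm2) (by nlinarith [hδ.1] : 0 ≤ (d:ℝ) - 1 - δ)]
    have hdd : (0 : ℝ) < d * (d - 1) := by positivity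
    have : c * ((m : ℝ) * (m - 1) / 2) * (d * (d - 1)) < ((m : ℝ) - 1 - δ) * (d * (d - 1)) := by
      have : c * ((m : ℝ) * (m - 1) / 2) * (d * (d - 1)) =
        ((d : ℝ) - 1 - δ) * (m * (m - 1)) := by
        linear_combination ((m : ℝ) * (m - 1) / 2) * hcmul
      rw [this]
      nlinarith [key]
    exact lt_of_mul_lt_mul_right this hdd.le
  have ev1 : ∀ᶠ γ in nhdsWithin c (Set.Ioi c), γ < 1 - β :=
    nhdsWithin_le_nhds (Iio_mem_nhds hc1)
  have ev2 : ∀ᶠ γ in nhdsWithin c (Set.Ioi c),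
      ∀ m ∈ Finset.Ico 2 d, γ * (m.choose 2 : ℕ) < (m : ℝ) - 1 - δ := by
    rw [Filter.eventually_all_finset]
    intro m hm
    apply nhdsWithin_le_nhds
    exact (Continuous.tendsto (continuous_id.mul continuous_const) c).eventually_lt_const
      (hc2 m hm)
  have ev3 : ∀ᶠ γ in nhdsWithin c (Set.Ioi c), c < γ := self_mem_nhdsWithin
  obtain ⟨γ, h1, h2, h3⟩ := (ev1.and (ev2.and ev3)).exists
  refine ⟨γ, hc0.trans h3, h1, ?_, h2⟩
  rw [Nat.cast_choose_two]
  have : (0 : ℝ) < d * (d - 1) := by positivity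
  nlinarith

/-- when `δ < (d−1)/(d+1)`, `β < 2δ/(d(d−1)) + (d−2)/d` and
`liminf p_n > 0`, the clique estimator achieves partial reconstruction. -/
theorem clique_estimator_partial
    (d : ℕ) (hd : 2 ≤ d) (δ β : ℝ)
    (hδ : 0 ≤ δ ∧ δ < ((d : ℝ) - 1) / ((d : ℝ) + 1))
    (hβ : 0 ≤ β ∧ β < 2 * δ / ((d : ℝ) * ((d : ℝ) - 1)) + ((d : ℝ) - 2) / (d : ℝ))
    (s p q : ℕ → ℝ)
    (hs01 : ∀ n, 0 < s n ∧ s n ≤ 1)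
    (hp01 : ∀ n, 0 ≤ p n ∧ p n ≤ 1)
    (hq01 : ∀ n, 0 ≤ q n ∧ q n ≤ 1)
    (hqp : ∀ n, q n ≤ p n)
    (hs : Tendsto (fun n : ℕ => Real.log (s n) / Real.log n) atTop
      (nhds (-((d : ℝ) - 1) + δ)))
    (hq : Tendsto (fun n : ℕ => Real.log (q n) / Real.log n) atTop (nhds (-1 + β)))
    (hp : 0 < atTop.liminf p) :
    atTop.limsup (fun n : ℕ =>
        (∑ H ∈ (dsets n d).powerset, ∑ A ∈ (pairs n).powerset,
            joint n d (s n) (p n) (q n) H A * ((cliqueEst n d A ∆ H).card : ℝ))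
          / (s n * (n.choose d : ℝ))) < 1 := by
  obtain ⟨γ, hγ0, hγβ, hγd, hγm⟩ := exists_gamma d hd δ β hδ hβ
  obtain ⟨c, hc0, hcp⟩ := exists_between hp
  have hbdd : IsBoundedUnder (· ≥ ·) atTop p :=
    isBoundedUnder_of ⟨0, fun n => (hp01 n).1⟩
  have evp : ∀ᶠ n in atTop, c < p n := eventually_lt_of_lt_liminf hcp hbdd
  have hc1 : c ≤ 1 := by
    obtain ⟨n, hn⟩ := evp.exists
    exact hn.le.trans (hp01 n).2
  set K := d.choose 2 with hK
  have hcK : 0 < c ^ K := by positivity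
  set η : ℝ := (γ * K - ((d : ℝ) - 1 - δ)) / 2 with hη
  have hη0 : 0 < η := by rw [hη]; linarith
  have evn : ∀ᶠ n : ℕ in atTop, 2 ≤ n := eventually_ge_atTop 2
  have evq : ∀ᶠ n : ℕ in atTop, Real.log (q n) / Real.log n < -γ :=
    hq.eventually_lt_const (by linarith)
  have evs : ∀ᶠ n : ℕ in atTop, -(γ * K) + η < Real.log (s n) / Real.log n :=
    hs.eventually_const_lt (by rw [hη]; linarith)
  have evm : ∀ᶠ n : ℕ in atTop, ∀ m ∈ Finset.Ico 2 d,
      Real.log (s n) / Real.log n < -((d : ℝ) - m) - γ * (m.choose 2 : ℕ) := by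
    rw [Filter.eventually_all_finset]
    intro m hm
    exact hs.eventually_lt_const (by linarith [hγm m hm])
  have evη : ∀ᶠ n : ℕ in atTop, (n : ℝ) ^ (-η) * Real.exp (d * 2 ^ d) < c ^ K / 2 := by
    have h1 : Tendsto (fun n : ℕ => (n : ℝ) ^ (-η) * Real.exp (d * 2 ^ d)) atTop
        (nhds (0 * Real.exp (d * 2 ^ d))) :=
      ((tendsto_rpow_neg_atTop hη0).comp tendsto_natCast_atTop_atTop).mul_const _
    rw [zero_mul] at h1
    exact h1.eventually_lt_const (by positivity)
  have main : ∀ᶠ n : ℕ in atTop, (∑ H ∈ (dsets n d).powerset, ∑ A ∈ (pairs n).powerset,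
            joint n d (s n) (p n) (q n) H A * ((cliqueEst n d A ∆ H).card : ℝ))
          / (s n * (n.choose d : ℝ)) ≤ 1 - c ^ K / 2 := by
    filter_upwards [evp, evn, evq, evs, evm, evη, eventually_ge_atTop d] with
      n hpn hn hqn hsn hmn hηn hdn
    have hn1 : (1 : ℝ) < n := by exact_mod_cast hn
    have hn0 : (0 : ℝ) < n := by linarith
    have hlog : 0 < Real.log n := Real.log_pos hn1
    have hs0 := (hs01 n).1
    set t : ℝ := (n : ℝ) ^ (-γ) with ht
    have ht0 : 0 < t := Real.rpow_pos_of_pos hn0 _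
    have ht1 : t ≤ 1 := Real.rpow_le_one_of_one_le_of_nonpos hn1.le (by linarith)
    have htpow : ∀ k : ℕ, t ^ k = (n : ℝ) ^ (-(γ * k)) := by
      intro k
      rw [ht, ← Real.rpow_natCast, ← Real.rpow_mul hn0.le]; congr 1; ring
    have hqt : q n ≤ t := by
      rcases (hq01 n).1.eq_or_lt with h | h
      · rw [← h]; exact ht0.le
      · rw [div_lt_iff₀ hlog] at hqn
        rw [ht, Real.rpow_def_of_pos hn0, ← Real.log_le_iff_le_exp h]
        linarith
    have hB : ∀ m ∈ Finset.Ico 2 d,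
        s n * (n : ℝ) ^ (d - m) * (t⁻¹) ^ (m.choose 2) ≤ 1 := by
      intro m hm
      have h := hmn m hm
      rw [div_lt_iff₀ hlog] at h
      have hsle : s n ≤ (n : ℝ) ^ (-((d : ℝ) - m) - γ * (m.choose 2 : ℕ)) := by
        rw [Real.rpow_def_of_pos hn0, ← Real.log_le_iff_le_exp hs0]
        linarith
      have hmd : m ≤ d := (Finset.mem_Ico.1 hm).2.le
      have e1 : (n : ℝ) ^ (d - m) = (n : ℝ) ^ ((d : ℝ) - m) := by
        rw [← Real.rpow_natCast, Nat.cast_sub hmd]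
      have e2 : (t⁻¹) ^ (m.choose 2) = (n : ℝ) ^ (γ * (m.choose 2 : ℕ)) := by
        rw [inv_pow, htpow, ← Real.rpow_neg hn0.le, neg_neg]
      rw [e1, e2]
      calc _ ≤ (n : ℝ) ^ (-((d : ℝ) - m) - γ * (m.choose 2 : ℕ)) * (n : ℝ) ^ ((d : ℝ) - m) *
            (n : ℝ) ^ (γ * (m.choose 2 : ℕ)) := by gcongr
        _ = 1 := by
          rw [← Real.rpow_add hn0, ← Real.rpow_add hn0]
          rw [show -((d : ℝ) - m) - γ * (m.choose 2 : ℕ) + ((d : ℝ) - m) +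
            γ * (m.choose 2 : ℕ) = 0 by ring, Real.rpow_zero]
    have hr := risk_bound n d (s n) (p n) (q n) t hs0 (hs01 n).2 (hp01 n).1 (hp01 n).2
      (hq01 n).1 hqt ht0 ht1 hB
    have hch : (0 : ℝ) < n.choose d := by exact_mod_cast Nat.choose_pos hdn
    rw [div_le_iff₀ (by positivity)]
    refine hr.trans ?_
    have htK : t ^ K ≤ s n * (n : ℝ) ^ (-η) := by
      rw [lt_div_iff₀ hlog] at hsn
      have hsge : (n : ℝ) ^ (-(γ * K) + η) ≤ s n := by
        rw [Real.rpow_def_of_pos hn0, ← Real.le_log_iff_exp_le hs0]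
        linarith
      calc t ^ K = (n : ℝ) ^ (-(γ * K) + η) * (n : ℝ) ^ (-η) := by
            rw [htpow, ← Real.rpow_add hn0]; congr 1; ring
        _ ≤ _ := by gcongr
    have hpK : c ^ K ≤ p n ^ K := pow_le_pow_left₀ hc0.le hpn.le _
    have hE : t ^ K * Real.exp (d * 2 ^ d) ≤ s n * (c ^ K / 2) := by
      calc _ ≤ s n * (n : ℝ) ^ (-η) * Real.exp (d * 2 ^ d) := by gcongr
        _ = s n * ((n : ℝ) ^ (-η) * Real.exp (d * 2 ^ d)) := by ring
        _ ≤ _ := by gcongr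
    have : s n * (1 - p n ^ K) + t ^ K * Real.exp (d * 2 ^ d) ≤ s n * (1 - c ^ K / 2) := by
      have := mul_le_mul_of_nonneg_left hpK hs0.le
      linarith
    calc _ ≤ (n.choose d : ℝ) * (s n * (1 - c ^ K / 2)) :=
          mul_le_mul_of_nonneg_left this hch.le
      _ = _ := by ring
  refine lt_of_le_of_lt (limsup_le_of_le ?_ main) (by linarith)
  apply IsBoundedUnder.isCoboundedUnder_le
  refine isBoundedUnder_of ⟨0, fun n => ?_⟩
  apply div_nonneg
  · apply Finset.sum_nonneg; intro H _
    apply Finset.sum_nonneg; intro A _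
    apply mul_nonneg _ (Nat.cast_nonneg _)
    exact mul_nonneg (mu_nonneg n d _ (hs01 n).1.le (hs01 n).2 H)
      (condP_nonneg n _ _ (hp01 n).1 (hp01 n).2 (hq01 n).1 (hq01 n).2 H A)
  · exact mul_nonneg (hs01 n).1.le (Nat.cast_nonneg _)


end NoisyHypergraph
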